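/- arXiv:2605.00705 — 3 statements merged into one kernel-verified Lean document; each statement's English description precedes it below -/
import Mathlib

section
/- For every n ≥ 1 and every r with 0 ≤ r < n, the set Θ_n consisting of all 2^{n−1} antipodal generators {a, ā} (a ∈ Q_n) is admissible. -/
/-- The integer in `{0, …, 2^n − 1}` corresponding to a vertex of `Q_n` via
binary expansion. -/
def val {n : ℕ} (a : Fin n → Bool) : ℕ := ∑ i, if a i then 2 ^ (i : ℕ) else 0

/-- A generator (for parameters `n, r`): an unordered pair `{a,b}` of distinct
vertices of `Q_n` with `d_H(a,b) > r`, normalised so that `val fst < val snd`. -/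
structure Gen (n r : ℕ) where
  fst : Fin n → Bool
  snd : Fin n → Bool
  hval : val fst < val snd
  hdist : r < hammingDist fst snd

/-- The order on generators: first by Hamming distance, then lexicographically
on the pair of integers (identifying vertices with integers via binary
expansion). -/
def genLT {n r : ℕ} (p q : Gen n r) : Prop :=
  hammingDist p.fst p.snd < hammingDist q.fst q.snd ∨
    (hammingDist p.fst p.snd = hammingDist q.fst q.snd ∧
      (val p.fst < val q.fst ∨ (p.fst = q.fst ∧ val p.snd < val q.snd)))

/-- The two endpoints of a generator, viewed as a two-element subset of `Q_n`. -/
def ends {n r : ℕ} (p : Gen n r) : Set (Fin n → Bool) := {p.fst, p.snd}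

/-- The union of the endpoints of all generators of `I` that are `≤ p`
(the initial segment of `I` determined by `p`). -/
def initUnion {n r : ℕ} (I : Set (Gen n r)) (p : Gen n r) : Set (Fin n → Bool) :=
  {x | ∃ p' ∈ I, (p' = p ∨ genLT p' p) ∧ x ∈ ends p'}

/-- A set `I` of generators is admissible if for every `p ∈ I` and every
generator `q > p`, the two-element set `q` is not contained in the union of the
generators of `I` that are `≤ p`. -/
def admissible {n r : ℕ} (I : Set (Gen n r)) : Prop :=
  ∀ p ∈ I, ∀ q : Gen n r, genLT p q → ¬ (ends q ⊆ initUnion I p)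

/-- `Θ_n`: the set of all antipodal generators `{a, ā}`, i.e. those of Hamming
distance `n`. -/
def Theta (n r : ℕ) : Set (Gen n r) := {p | hammingDist p.fst p.snd = n}

/-- Two vertices at Hamming distance `n` in `Q_n` are complements of each other. -/
theorem eq_not_of_hammingDist_eq {n : ℕ} {a b : Fin n → Bool} (h : hammingDist a b = n) :
    b = fun i => !a i := by
  have huniv : (Finset.univ.filter fun i => a i ≠ b i) = Finset.univ :=
    Finset.eq_univ_of_card _ (by simpa [hammingDist] using h)
  funext i
  have hi : a i ≠ b i := Finset.filter_eq_self.mp huniv i (Finset.mem_univ i)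
  exact Bool.eq_not.mpr hi.symm

/-- Among antipodal generators, the order is decided by the smaller endpoint. -/
theorem val_fst_lt_of_genLT {n r : ℕ} {p q : Gen n r} (hp : p ∈ Theta n r) (hq : q ∈ Theta n r)
    (h : genLT p q) : val p.fst < val q.fst := by
  have hp' : hammingDist p.fst p.snd = n := hp
  have hq' : hammingDist q.fst q.snd = n := hq
  rcases h with h | ⟨-, h | ⟨hfst, hsnd⟩⟩
  · omega
  · exact h
  · rw [eq_not_of_hammingDist_eq hp', eq_not_of_hammingDist_eq hq', hfst] at hsnd
    exact absurd hsnd (lt_irrefl _)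

/-- For every `n ≥ 1` and `0 ≤ r < n`, the set `Θ_n` of all `2^{n−1}` antipodal
generators is admissible. -/
theorem theta_admissible (n r : ℕ) (h1 : 1 ≤ n) (h2 : r < n) :
    admissible (Theta n r) := by
  intro p hp q hpq hsub
  have hp' : hammingDist p.fst p.snd = n := hp
  have hq : hammingDist q.fst q.snd = n := by
    have hle : hammingDist q.fst q.snd ≤ n := by
      simpa using hammingDist_le_card_fintype (x := q.fst) (y := q.snd)
    rcases hpq with h | ⟨h, -⟩ <;> omega
  have hlt := val_fst_lt_of_genLT hp hq hpq
  obtain ⟨p', hmem, hle, hend⟩ := hsub (show q.fst ∈ ends q from Or.inl rfl)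
  have hle' : val p'.fst ≤ val p.fst := by
    rcases hle with rfl | h
    · exact le_rfl
    · exact (val_fst_lt_of_genLT hmem hp h).le
  rcases hend with h | h
  · rw [h] at hlt
    omega
  · have h : q.fst = p'.snd := h
    have hsnd : q.snd = p'.fst := by
      rw [eq_not_of_hammingDist_eq hq, h, eq_not_of_hammingDist_eq hmem]
      simp
    have hval := q.hval
    rw [h, hsnd] at hval
    exact lt_asymm hval p'.hval
end

section
/- If a finite set I of generators (for parameters n, r) is not admissible, then there exist generators p, q ∈ I with p < q such that the two-element set {p, q} is not admissible. -/
theorem val_succ {n : ℕ} (a : Fin (n + 1) → Bool) :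
    val a = (if a 0 then 1 else 0) + 2 * val (fun i => a i.succ) := by
  simp [val, Fin.sum_univ_succ, Finset.mul_sum, pow_succ, mul_comm]

theorem val_injective (n : ℕ) : Function.Injective (val : (Fin n → Bool) → ℕ) := by
  induction n with
  | zero => exact fun a b _ => Subsingleton.elim a b
  | succ n ih =>
    intro a b hab
    rw [val_succ, val_succ] at hab
    have hzero : a 0 = b 0 := by
      cases ha : a 0 <;> cases hb : b 0 <;> simp [ha, hb] at hab ⊢ <;> omega
    rw [hzero] at hab
    have htail : (fun i : Fin n => a i.succ) = fun i => b i.succ := ih (by omega)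
    funext i
    exact Fin.cases hzero (congrFun htail) i

theorem genLT_irrefl {n r : ℕ} (p : Gen n r) : ¬ genLT p p := by
  simp [genLT]

theorem genLT_trans {n r : ℕ} {p q s : Gen n r} (hpq : genLT p q) (hqs : genLT q s) :
    genLT p s := by
  unfold genLT at *
  grind

theorem genLT_trichotomy {n r : ℕ} (p q : Gen n r) : genLT p q ∨ p = q ∨ genLT q p := by
  have hfst := @val_injective n p.fst q.fst
  have hsnd := @val_injective n p.snd q.snd
  unfold genLT
  cases p
  cases q
  simp only [Gen.mk.injEq] at *
  grind

theorem eq_of_ends_subset {n r : ℕ} {p q : Gen n r} (h : ends q ⊆ ends p) : q = p := by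
  have hfst : q.fst = p.fst ∨ q.fst = p.snd := h (Or.inl rfl)
  have hsnd : q.snd = p.fst ∨ q.snd = p.snd := h (Or.inr rfl)
  have hp := p.hval
  have hq := q.hval
  cases p
  cases q
  simp only [Gen.mk.injEq] at *
  grind

/-- A pair `p < q` is not admissible if some generator above `q` is covered by `p` and `q`. -/
theorem not_admissible_pair {n r : ℕ} {p q s : Gen n r} (hpq : genLT p q) (hqs : genLT q s)
    (hs : ends s ⊆ ends p ∪ ends q) : ¬ admissible {p, q} := by
  intro hadm
  refine hadm q (Or.inr rfl) s hqs fun x hx => ?_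
  rcases hs hx with hxp | hxq
  · exact ⟨p, Or.inl rfl, Or.inr hpq, hxp⟩
  · exact ⟨q, Or.inr rfl, Or.inl rfl, hxq⟩

/-- If a finite set `I` of generators is not admissible, then there are
generators `p < q` in `I` such that the two-element set `{p, q}` is not
admissible. -/
theorem not_admissible_pair_of_not_admissible (n r : ℕ)
    (I : Set (Gen n r)) (hfin : I.Finite) (h : ¬ admissible I) :
    ∃ p ∈ I, ∃ q ∈ I, genLT p q ∧ ¬ admissible {p, q} := by
  unfold admissible at h
  push Not at h
  obtain ⟨m, -, s, hms, hsub⟩ := h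
  obtain ⟨p, hpI, hpm, hp⟩ := hsub (Or.inl rfl : s.fst ∈ ends s)
  obtain ⟨q, hqI, hqm, hq⟩ := hsub (Or.inr rfl : s.snd ∈ ends s)
  have hps : genLT p s := hpm.elim (fun e => e ▸ hms) (genLT_trans · hms)
  have hqs : genLT q s := hqm.elim (fun e => e ▸ hms) (genLT_trans · hms)
  have hcover : ends s ⊆ ends p ∪ ends q := by
    rintro x (rfl | rfl)
    · exact Or.inl hp
    · exact Or.inr hq
  rcases genLT_trichotomy p q with hlt | rfl | hlt
  · exact ⟨p, hpI, q, hqI, hlt, not_admissible_pair hlt hqs hcover⟩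
  · rw [Set.union_self] at hcover
    exact absurd (eq_of_ends_subset hcover ▸ hps) (genLT_irrefl p)
  · exact ⟨q, hqI, p, hpI, hlt, not_admissible_pair hlt hps (Set.union_comm _ _ ▸ hcover)⟩
end

section
/- Let v ∈ Q_5 and let {i,j,k,l,m} = {1,2,3,4,5}. Consider the five pairs P_1 = {v^i, v^{jklm}}, P_2 = {v^j, v^{iklm}}, P_3 = {v^k, v^{ijlm}}, P_4 = {v^l, v^{ijkm}}, P_5 = {v^m, v^{ijkl}}. Then the ten vertices are pairwise distinct, the two vertices of each pair P_t are at Hamming distance 5, and any two vertices lying in different pairs are at Hamming distance at most 3. Consequently, every subset of these ten vertices containing no complete pair P_t has Hamming diameter at most 3, so the join P_1 * P_2 * P_3 * P_4 * P_5 (the boundary of a 5-dimensional cross polytope) is a subcomplex of VR(Q_5;3). -/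
/-- `flipSet v T` is the vertex `v^T` of `Q_5` obtained from `v` by flipping the
coordinates in `T`. -/
def flipSet (v : Fin 5 → Bool) (T : Finset (Fin 5)) : Fin 5 → Bool :=
  fun x => if x ∈ T then !(v x) else v x

theorem hammingDist_flipSet (v : Fin 5 → Bool) (S T : Finset (Fin 5)) :
    hammingDist (flipSet v S) (flipSet v T) = (symmDiff S T).card := by
  unfold hammingDist
  congr 1
  ext x
  rw [Finset.mem_filter_univ]
  by_cases hS : x ∈ S <;> by_cases hT : x ∈ T <;>
    simp [flipSet, Finset.mem_symmDiff, hS, hT]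

theorem card_symmDiff_singleton_compl (a : Fin 5) :
    (symmDiff {a} ({a}ᶜ : Finset (Fin 5))).card = 5 := by
  revert a
  decide

/-- The flip set `{a}` of the first vertex of a pair, or `{a}ᶜ` of the second one. -/
def pairFlips (a : Fin 5) (b : Bool) : Finset (Fin 5) :=
  if b then {a} else {a}ᶜ

theorem card_symmDiff_pairFlips_le {a a' : Fin 5} (h : a ≠ a') (b b' : Bool) :
    (symmDiff (pairFlips a b) (pairFlips a' b')).card ≤ 3 := by
  revert a a' b b'
  decide

theorem pairFlips_injective :
    Function.Injective (fun x : Fin 5 × Bool => pairFlips x.1 x.2) := by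
  decide

theorem flipSet_injective (v : Fin 5 → Bool) : Function.Injective (flipSet v) := by
  intro S T h
  have hd : hammingDist (flipSet v S) (flipSet v T) = 0 := by rw [h, hammingDist_self]
  rw [hammingDist_flipSet, Finset.card_eq_zero] at hd
  exact symmDiff_eq_bot.mp hd

/-- Family (A): for `v ∈ Q_5` and `{i,j,k,l,m} = {1,…,5}`, the five pairs
`P_1 = {v^i, v^{jklm}}, …, P_5 = {v^m, v^{ijkl}}` consist of ten pairwise
distinct vertices, each pair at Hamming distance 5, while vertices in
different pairs are at Hamming distance at most 3.  Consequently every subset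
of the ten vertices containing no complete pair has Hamming diameter at most
3, so the join `P_1 * … * P_5` (the boundary of a 5-dimensional cross
polytope) is a subcomplex of `VR(Q_5;3)`. -/
theorem crossPolytope_family_A (v : Fin 5 → Bool) (i j k l m : Fin 5)
    (hcov : ({i, j, k, l, m} : Finset (Fin 5)) = Finset.univ)
    (P : Fin 5 → ((Fin 5 → Bool) × (Fin 5 → Bool)))
    (hP0 : P 0 = (flipSet v {i}, flipSet v {j, k, l, m}))
    (hP1 : P 1 = (flipSet v {j}, flipSet v {i, k, l, m}))
    (hP2 : P 2 = (flipSet v {k}, flipSet v {i, j, l, m}))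
    (hP3 : P 3 = (flipSet v {l}, flipSet v {i, j, k, m}))
    (hP4 : P 4 = (flipSet v {m}, flipSet v {i, j, k, l})) :
    (Function.Injective
      (fun x : Fin 5 × Bool => if x.2 then (P x.1).1 else (P x.1).2)) ∧
    (∀ t : Fin 5, hammingDist (P t).1 (P t).2 = 5) ∧
    (∀ t s : Fin 5, t ≠ s → ∀ x y : Fin 5 → Bool,
      (x = (P t).1 ∨ x = (P t).2) → (y = (P s).1 ∨ y = (P s).2) →
      hammingDist x y ≤ 3) ∧
    (∀ σ : Finset (Fin 5 → Bool),
      (∀ x ∈ σ, ∃ t : Fin 5, x = (P t).1 ∨ x = (P t).2) →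
      (∀ t : Fin 5, ¬ ((P t).1 ∈ σ ∧ (P t).2 ∈ σ)) →
      ∀ x ∈ σ, ∀ y ∈ σ, hammingDist x y ≤ 3) := by
  have hsurj : Function.Surjective ![i, j, k, l, m] := by
    intro x
    have hx : x ∈ ({i, j, k, l, m} : Finset (Fin 5)) := hcov ▸ Finset.mem_univ x
    simp only [Finset.mem_insert, Finset.mem_singleton] at hx
    rcases hx with rfl | rfl | rfl | rfl | rfl
    exacts [⟨0, rfl⟩, ⟨1, rfl⟩, ⟨2, rfl⟩, ⟨3, rfl⟩, ⟨4, rfl⟩]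
  have hinj : Function.Injective ![i, j, k, l, m] := Finite.injective_iff_surjective.mpr hsurj
  obtain ⟨e, he⟩ : ∃ e, e = ![i, j, k, l, m] := ⟨_, rfl⟩
  rw [← he] at hsurj hinj
  have h0 : e 0 = i := by rw [he]; rfl
  have h1 : e 1 = j := by rw [he]; rfl
  have h2 : e 2 = k := by rw [he]; rfl
  have h3 : e 3 = l := by rw [he]; rfl
  have h4 : e 4 = m := by rw [he]; rfl
  clear he
  subst h0 h1 h2 h3 h4
  have hP : ∀ t, P t = (flipSet v (pairFlips (e t) true), flipSet v (pairFlips (e t) false)) := by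
    intro t
    fin_cases t <;> simp only [Fin.zero_eta, Fin.mk_one, Fin.reduceFinMk, *] <;> congr 2 <;>
      ext x <;> obtain ⟨s, rfl⟩ := hsurj x <;> fin_cases s <;> simp [pairFlips, hinj.eq_iff]
  have hmem : ∀ t x, (x = (P t).1 ∨ x = (P t).2) → ∃ b, x = flipSet v (pairFlips (e t) b) := by
    rintro t x (rfl | rfl)
    exacts [⟨true, by rw [hP]⟩, ⟨false, by rw [hP]⟩]
  have hdist : ∀ t s : Fin 5, t ≠ s → ∀ x y : Fin 5 → Bool,
      (x = (P t).1 ∨ x = (P t).2) → (y = (P s).1 ∨ y = (P s).2) → hammingDist x y ≤ 3 := by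
    intro t s hts x y hx hy
    obtain ⟨b, rfl⟩ := hmem t x hx
    obtain ⟨b', rfl⟩ := hmem s y hy
    rw [hammingDist_flipSet]
    exact card_symmDiff_pairFlips_le (hinj.ne hts) b b'
  refine ⟨?_, ?_, hdist, ?_⟩
  · have hfun : (fun x : Fin 5 × Bool => if x.2 then (P x.1).1 else (P x.1).2) =
        flipSet v ∘ (fun x : Fin 5 × Bool => pairFlips x.1 x.2) ∘ Prod.map e id := by
      funext ⟨t, b⟩
      cases b <;> simp [hP]
    rw [hfun]
    exact (flipSet_injective v).comp
      (pairFlips_injective.comp (hinj.prodMap Function.injective_id))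
  · intro t
    rw [hP, hammingDist_flipSet]
    exact card_symmDiff_singleton_compl (e t)
  · intro σ hσ hpair x hx y hy
    obtain ⟨t, ht⟩ := hσ x hx
    obtain ⟨s, hs⟩ := hσ y hy
    by_cases hts : t = s
    · subst hts
      rcases ht with rfl | rfl <;> rcases hs with rfl | rfl
      · simp
      · exact absurd ⟨hx, hy⟩ (hpair t)
      · exact absurd ⟨hy, hx⟩ (hpair t)
      · simp
    · exact hdist t s hts x y ht hs
end
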